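/- Let φ > 0 and consider the time-dependent Hamiltonian on (ℝ²∖{0}) × ℝ² given by H(s, q, p) = (1/2)|p − a(s, q)|², where a(s, q) = (1/2 − φ s/|q|²) q^⊥ and q^⊥ = (−q₂, q₁). Let (q, p) : I → (ℝ²∖{0}) × ℝ² be a differentiable solution of Hamilton's equations q′(s) = ∇_p H(s, q(s), p(s)), p′(s) = −∇_q H(s, q(s), p(s)) on an open interval I, let E(s) = (1/2)|p(s) − a(s, q(s))|² be the kinetic energy along the trajectory, and let θ : I → ℝ be a differentiable function such that q(s) = |q(s)| (cos θ(s), sin θ(s)) for all s ∈ I (a continuous determination of the polar angle of q(s)). Then the quantity K := E(s) − φ θ(s) is constant along the trajectory. -/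

import Mathlib

open MeasureTheory Filter Topology

noncomputable section

/-- The plane `ℝ²` with its Euclidean inner product structure. -/
abbrev Plane : Type := EuclideanSpace ℝ (Fin 2)

/-- Rotation by `π/2`: `q^⊥ = (-q₂, q₁)`. -/
def perp (q : Plane) : Plane := !₂[-(q 1), q 0]

/-- The time-dependent vector potential `a(s,q) = (1/2 - φ s / |q|²) q^⊥`. -/
def vecPot (φ s : ℝ) (q : Plane) : Plane := ((1 : ℝ)/2 - φ * s / ‖q‖^2) • perp q

/-- The time-dependent Hamiltonian `H(s,q,p) = (1/2)|p - a(s,q)|²`. -/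
def Ham (φ s : ℝ) (q p : Plane) : ℝ := (1/2) * ‖p - vecPot φ s q‖^2

/-- Hamilton's equations `q' = ∇_p H`, `p' = -∇_q H` hold at time `s`. -/
def HamiltonEqnsAt (φ : ℝ) (q p : ℝ → Plane) (s : ℝ) : Prop :=
  HasDerivAt q (gradient (fun y => Ham φ s (q s) y) (p s)) s ∧
    HasDerivAt p (-(gradient (fun x => Ham φ s x (p s)) (q s))) s

lemma abstract_total_deriv {V : Type*} [NormedAddCommGroup V] [InnerProductSpace ℝ V]
    [CompleteSpace V] (F : ℝ × V × V → ℝ) (s : ℝ) (q p : ℝ → V)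
    (hF : DifferentiableAt ℝ F (s, q s, p s))
    (hq : HasDerivAt q (gradient (fun y => F (s, q s, y)) (p s)) s)
    (hp : HasDerivAt p (-(gradient (fun x => F (s, x, p s)) (q s))) s) :
    HasDerivAt (fun t => F (t, q t, p t)) (deriv (fun t => F (t, q s, p s)) s) s := by
  have hF' := hF.hasFDerivAt
  set L := fderiv ℝ F (s, q s, p s)
  have hs : HasDerivAt (fun t => F (t, q s, p s)) (L (1, 0, 0)) s := by
    have hc : HasDerivAt (fun t : ℝ => (t, q s, p s)) ((1 : ℝ), (0 : V), (0 : V)) s :=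
      (hasDerivAt_id s).prodMk ((hasDerivAt_const s (q s)).prodMk (hasDerivAt_const s (p s)))
    exact HasFDerivAt.comp_hasDerivAt s hF' hc
  have hx : HasFDerivAt (fun x => F (s, x, p s))
      (L.comp ((0 : V →L[ℝ] ℝ).prod ((ContinuousLinearMap.id ℝ V).prod 0))) (q s) := by
    have hc : HasFDerivAt (fun x : V => (s, x, p s))
        ((0 : V →L[ℝ] ℝ).prod ((ContinuousLinearMap.id ℝ V).prod (0 : V →L[ℝ] V))) (q s) :=
      (hasFDerivAt_const s _).prodMk ((hasFDerivAt_id _).prodMk (hasFDerivAt_const _ _))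
    exact HasFDerivAt.comp (g := F) (q s) hF' hc
  have hy : HasFDerivAt (fun y => F (s, q s, y))
      (L.comp ((0 : V →L[ℝ] ℝ).prod ((0 : V →L[ℝ] V).prod (ContinuousLinearMap.id ℝ V))))
      (p s) := by
    have hc : HasFDerivAt (fun y : V => (s, q s, y))
        ((0 : V →L[ℝ] ℝ).prod ((0 : V →L[ℝ] V).prod (ContinuousLinearMap.id ℝ V))) (p s) :=
      (hasFDerivAt_const s _).prodMk ((hasFDerivAt_const _ _).prodMk (hasFDerivAt_id _))
    exact HasFDerivAt.comp (g := F) (p s) hF' hc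
  set A := gradient (fun y => F (s, q s, y)) (p s) with hA
  set B := gradient (fun x => F (s, x, p s)) (q s) with hB
  have hBL : ∀ v, L (0, v, 0) = inner ℝ B v := by
    intro v
    have := hx.fderiv
    rw [hB, gradient, InnerProductSpace.toDual_symm_apply, this]
    simp
  have hAL : ∀ v, L (0, 0, v) = inner ℝ A v := by
    intro v
    have := hy.fderiv
    rw [hA, gradient, InnerProductSpace.toDual_symm_apply, this]
    simp
  have htot : HasDerivAt (fun t => F (t, q t, p t)) (L (1, A, -B)) s :=
    HasFDerivAt.comp_hasDerivAt s hF' ((hasDerivAt_id s).prodMk (hq.prodMk hp))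
  rw [hs.deriv]
  refine htot.congr_deriv ?_
  have : ((1 : ℝ), A, -B) = (1, 0, 0) + (0, A, 0) + (0, 0, -B) := by simp
  rw [this, map_add, map_add, hBL, hAL, inner_neg_right, real_inner_comm]
  ring

lemma ham_total_deriv (φ s : ℝ) (q p : ℝ → Plane) (h0 : q s ≠ 0)
    (h : HamiltonEqnsAt φ q p s) :
    HasDerivAt (fun t => Ham φ t (q t) (p t))
      (deriv (fun t => Ham φ t (q s) (p s)) s) s := by
  obtain ⟨hq, hp⟩ := h
  have hnorm : ‖q s‖ ^ 2 ≠ 0 := by simpa using h0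
  let F : ℝ × Plane × Plane → ℝ := fun z => Ham φ z.1 z.2.1 z.2.2
  have hperp : Differentiable ℝ perp := by
    unfold perp
    rw [differentiable_euclidean]
    intro i
    fin_cases i <;> simp <;> fun_prop
  have hF : DifferentiableAt ℝ F (s, q s, p s) := by
    have h1 : DifferentiableAt ℝ (fun z : ℝ × Plane × Plane => ‖z.2.1‖ ^ 2) (s, q s, p s) := by
      apply DifferentiableAt.norm_sq ℝ
      fun_prop
    have h2 : DifferentiableAt ℝ (fun z : ℝ × Plane × Plane => vecPot φ z.1 z.2.1) (s, q s, p s) := by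
      unfold vecPot
      apply DifferentiableAt.fun_smul
      · apply DifferentiableAt.fun_sub (by fun_prop)
        have h3 : DifferentiableAt ℝ (fun z : ℝ × Plane × Plane => φ * z.1) (s, q s, p s) := by
          fun_prop
        simp only [div_eq_mul_inv]
        exact h3.mul (h1.inv hnorm)
      · exact (hperp _).comp _ (by fun_prop)
    show DifferentiableAt ℝ (fun z : ℝ × Plane × Plane => (1/2) * ‖z.2.2 - vecPot φ z.1 z.2.1‖^2) _
    apply DifferentiableAt.const_mul
    apply DifferentiableAt.norm_sq ℝ
    exact DifferentiableAt.sub (by fun_prop) h2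
  exact abstract_total_deriv F s q p hF hq hp

lemma ham_time_deriv (φ s : ℝ) (q p : Plane) :
    HasDerivAt (fun t => Ham φ t q p)
      (φ / ‖q‖ ^ 2 * inner ℝ (p - vecPot φ s q) (perp q)) s := by
  have h1 : HasDerivAt (fun t => p - vecPot φ t q) ((φ / ‖q‖ ^ 2) • perp q) s := by
    unfold vecPot
    have : HasDerivAt (fun t : ℝ => (1 : ℝ) / 2 - φ * t / ‖q‖ ^ 2) (-(φ * 1 / ‖q‖ ^ 2)) s :=
      (((hasDerivAt_id s).const_mul φ).div_const _).const_sub _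
    have := (this.smul_const (perp q)).const_sub p
    refine this.congr_deriv ?_
    rw [neg_smul, neg_neg, mul_one]
  have := (h1.norm_sq).const_mul (1 / 2 : ℝ)
  unfold Ham
  refine this.congr_deriv ?_
  rw [inner_smul_right]
  ring

lemma ham_grad_p (φ s : ℝ) (q p : Plane) :
    gradient (fun y => Ham φ s q y) p = p - vecPot φ s q := by
  apply HasGradientAt.gradient
  rw [hasGradientAt_iff_hasFDerivAt]
  have h1 : HasFDerivAt (fun y : Plane => y - vecPot φ s q) (ContinuousLinearMap.id ℝ Plane) p :=
    (hasFDerivAt_id p).sub_const _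
  have := (h1.norm_sq).const_mul (1 / 2 : ℝ)
  unfold Ham
  refine this.congr_fderiv ?_
  ext v
  simp

lemma angle_deriv (q : ℝ → Plane) (θ : ℝ → ℝ) (s : ℝ) (q' : Plane) (h0 : q s ≠ 0)
    (hq : HasDerivAt q q' s) (hθd : DifferentiableAt ℝ θ s)
    (hθ : ∀ᶠ t in 𝓝 s, q t = ‖q t‖ • (!₂[Real.cos (θ t), Real.sin (θ t)] : Plane)) :
    inner ℝ q' (perp (q s)) = ‖q s‖ ^ 2 * deriv θ s := by
  have hc := fun i => ((EuclideanSpace.proj i : Plane →L[ℝ] ℝ)).hasFDerivAt.comp_hasDerivAt s hq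
  have hr := (hq.differentiableAt.norm ℝ h0).hasDerivAt
  have ht := hθd.hasDerivAt
  have e0 := (hc 0).unique ((hr.mul ht.cos).congr_of_eventuallyEq
    (hθ.mono fun t h => by simpa using congrArg (fun v : Plane => v 0) h))
  have e1 := (hc 1).unique ((hr.mul ht.sin).congr_of_eventuallyEq
    (hθ.mono fun t h => by simpa using congrArg (fun v : Plane => v 1) h))
  have hs := hθ.self_of_nhds
  have x0 : q s 0 = ‖q s‖ * Real.cos (θ s) := by simpa using congrArg (fun v : Plane => v 0) hs
  have x1 : q s 1 = ‖q s‖ * Real.sin (θ s) := by simpa using congrArg (fun v : Plane => v 1) hs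
  have hi : inner ℝ q' (perp (q s)) = q' 1 * q s 0 - q' 0 * q s 1 := by
    simp [perp, PiLp.inner_apply, Fin.sum_univ_two]
    ring
  change q' 0 = _ at e0
  change q' 1 = _ at e1
  rw [hi, e0, e1, x0, x1]
  linear_combination (‖q s‖ ^ 2 * deriv θ s) * Real.sin_sq_add_cos_sq (θ s)

/-- Along any solution of Hamilton's equations on an open interval
`(a,b)`, with energy `E(s) = |p - a(s,q)|²/2` and a differentiable determination
`θ` of the polar angle of `q`, the quantity `K = E(s) - φ θ(s)` is constant. -/
theorem energy_angle_integral_of_motion (φ : ℝ) (hφ : 0 < φ) (a b : ℝ)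
    (q p : ℝ → Plane)
    (hq0 : ∀ s ∈ Set.Ioo a b, q s ≠ 0)
    (hham : ∀ s ∈ Set.Ioo a b, HamiltonEqnsAt φ q p s)
    (E : ℝ → ℝ) (hE : ∀ s, E s = (1/2) * ‖p s - vecPot φ s (q s)‖^2)
    (θ : ℝ → ℝ) (hθdiff : ∀ s ∈ Set.Ioo a b, DifferentiableAt ℝ θ s)
    (hθ : ∀ s ∈ Set.Ioo a b,
      q s = ‖q s‖ • (!₂[Real.cos (θ s), Real.sin (θ s)] : Plane)) :
    ∀ s₁ ∈ Set.Ioo a b, ∀ s₂ ∈ Set.Ioo a b,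
      E s₁ - φ * θ s₁ = E s₂ - φ * θ s₂ := by
  have hd : ∀ s ∈ Set.Ioo a b, HasDerivAt (fun t => E t - φ * θ t) 0 s := by
    intro s hs
    have hEf : E = fun t => Ham φ t (q t) (p t) := funext hE
    have h1 := ham_total_deriv φ s q p (hq0 s hs) (hham s hs)
    have h2 := angle_deriv q θ s _ (hq0 s hs) (hham s hs).1 (hθdiff s hs)
      (Filter.eventually_of_mem (isOpen_Ioo.mem_nhds hs) hθ)
    rw [ham_grad_p] at h2
    rw [(ham_time_deriv φ s (q s) (p s)).deriv, h2, ← hEf] at h1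
    have hn : ‖q s‖ ^ 2 ≠ 0 := by simpa using hq0 s hs
    have h3 := h1.sub ((hθdiff s hs).hasDerivAt.const_mul φ)
    refine h3.congr_deriv ?_
    rw [← mul_assoc, div_mul_cancel₀ _ hn, sub_self]
  intro s₁ h₁ s₂ h₂
  exact isOpen_Ioo.is_const_of_deriv_eq_zero isPreconnected_Ioo
    (fun s hs => (hd s hs).differentiableAt.differentiableWithinAt)
    (fun s hs => (hd s hs).deriv) h₁ h₂
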